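/- Let k ≥ 1, x ≥ 1, w ≥ 0 and s ≥ 1 be integers, and suppose that either (1) x ≡ 0 (mod 4), w ≥ 1, and (2k−12w+2)/4 ≤ s ≤ (6k−12w−5)/4, or (2) x ≡ 1 (mod 4) and (2k−12w−1)/4 ≤ s ≤ (6k−12w−8)/4. If a graceful labelling of C_3^{4w+x} C_4^{s} exists, then a graceful labelling of C_3^{4w+x} C_4^{s+4k−1} exists. -/

import Mathlib

/-- The vertex type of a windmill whose vanes are cycles of lengths given by the list `L`:
`none` is the central vertex, and `some ⟨i, j⟩` is the `j`-th non-central vertex of the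
`i`-th vane (a cycle of length `L.get i`, contributing `L.get i - 1` non-central vertices). -/
abbrev WindmillVertex (L : List ℕ) : Type :=
  Option (Σ i : Fin L.length, Fin (L.get i - 1))

/-- Base relation for the windmill graph: the central vertex is joined to the two ends of
each vane's path, and consecutive vertices along each vane's path are joined. -/
def windmillRel (L : List ℕ) : WindmillVertex L → WindmillVertex L → Prop
  | none, some ⟨i, j⟩ => j.val = 0 ∨ j.val + 2 = L.get i
  | some ⟨i, j⟩, some ⟨i', j'⟩ => i.val = i'.val ∧ j'.val = j.val + 1
  | _, _ => False

/-- The windmill graph with vanes of cycle lengths given by `L`, all sharing one central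
vertex.  `Windmill (List.replicate t n)` is `Cₙᵗ`. -/
def Windmill (L : List ℕ) : SimpleGraph (WindmillVertex L) :=
  SimpleGraph.fromRel (windmillRel L)

/-- The edge label induced by a vertex labelling `f`: the absolute difference of the labels
of the two endpoints. -/
def edgeLabel {V : Type*} (f : V → ℕ) : Sym2 V → ℕ :=
  Sym2.lift ⟨fun u v => ((f u : ℤ) - (f v : ℤ)).natAbs,
    fun u v => by dsimp only; omega⟩

/-- `f` is a graceful labelling of the graph `G` with `m` edges: `f` is an injective map
into `{0, …, m}` and the induced edge labelling is a bijection onto `{1, …, m}`. -/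
def IsGracefulLabelling {V : Type*} (G : SimpleGraph V) (m : ℕ) (f : V → ℕ) : Prop :=
  Function.Injective f ∧ (∀ v, f v ≤ m) ∧
    Set.BijOn (edgeLabel f) G.edgeSet (Set.Icc 1 m)

/-- The graph `G`, with `m` edges, is graceful. -/
def IsGraceful {V : Type*} (G : SimpleGraph V) (m : ℕ) : Prop :=
  ∃ f, IsGracefulLabelling G m f

/-- `f` is a near graceful labelling of the graph `G` with `m` edges: `f` is an injective
map into `{0, …, m+1}` and the induced edge labelling is a bijection onto either
`{1, …, m}` or `{1, …, m-1, m+1}`. -/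
def IsNearGracefulLabelling {V : Type*} (G : SimpleGraph V) (m : ℕ) (f : V → ℕ) : Prop :=
  Function.Injective f ∧ (∀ v, f v ≤ m + 1) ∧
    (Set.BijOn (edgeLabel f) G.edgeSet (Set.Icc 1 m) ∨
      Set.BijOn (edgeLabel f) G.edgeSet (Set.Icc 1 (m - 1) ∪ {m + 1}))

/-- The graph `G`, with `m` edges, is near graceful. -/
def IsNearGraceful {V : Type*} (G : SimpleGraph V) (m : ℕ) : Prop :=
  ∃ f, IsNearGracefulLabelling G m f


/-- Skolem-type partition of `(t, 3t]` into pairs with differences `1, …, t`. -/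
def SkolemSys (t : ℕ) : Prop :=
  ∃ a : ℕ → ℕ, (∀ i, 1 ≤ i → i ≤ t → t < a i ∧ a i + i ≤ 3 * t) ∧
    ∀ e, t < e → e ≤ 3 * t → ∃ i, 1 ≤ i ∧ i ≤ t ∧ (e = a i ∨ e = a i + i)

lemma skolem_small1 : SkolemSys 1 := by
  refine ⟨fun _ => 2, ?_, ?_⟩
  · intro i h1 h2; dsimp only; omega
  · intro e h1 h2; exact ⟨1, by omega, by omega, by dsimp only; omega⟩

lemma skolem_small4 : SkolemSys 4 := by
  refine ⟨fun i => 4 + if i = 1 then 7 else if i = 2 then 2 else if i = 3 then 3 else 1, ?_, ?_⟩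
  · intro i h1 h2; dsimp only; split_ifs <;> omega
  · intro e h1 h2
    interval_cases e
    · exact ⟨4, by decide⟩
    · exact ⟨2, by decide⟩
    · exact ⟨3, by decide⟩
    · exact ⟨2, by decide⟩
    · exact ⟨4, by decide⟩
    · exact ⟨3, by decide⟩
    · exact ⟨1, by decide⟩
    · exact ⟨1, by decide⟩

lemma skolem_small5 : SkolemSys 5 := by
  refine ⟨fun i => 5 + if i = 1 then 8 else if i = 2 then 1 else if i = 3 then 4 else
    if i = 4 then 2 else 5, ?_, ?_⟩
  · intro i h1 h2; dsimp only; split_ifs <;> omega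
  · intro e h1 h2
    interval_cases e
    · exact ⟨2, by decide⟩
    · exact ⟨4, by decide⟩
    · exact ⟨2, by decide⟩
    · exact ⟨3, by decide⟩
    · exact ⟨5, by decide⟩
    · exact ⟨4, by decide⟩
    · exact ⟨3, by decide⟩
    · exact ⟨1, by decide⟩
    · exact ⟨1, by decide⟩
    · exact ⟨5, by decide⟩

set_option maxHeartbeats 2000000 in
lemma skolem_zero (m : ℕ) (hm : 2 ≤ m) : SkolemSys (4 * m) := by
  refine ⟨fun i => 4 * m + if i % 2 = 0 then 6 * m - i / 2 else
    if i = 4 * m - 1 then 2 * m + 1 else if i = 2 * m + 1 then m - 1 else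
    if i = 2 * m - 1 then 2 * m else if i = 1 then m else
    if 2 * m + 3 ≤ i then (4 * m - 1 - i) / 2 else m + 1 + (2 * m - 1 - i) / 2, ?_, ?_⟩
  · intro i h1 h2; dsimp only; split_ifs <;> omega
  · intro e h1 h2
    obtain ⟨p, rfl⟩ : ∃ p, e = 4 * m + p := ⟨e - 4 * m, by omega⟩
    by_cases c1 : 4 * m ≤ p
    · by_cases c2 : p < 6 * m
      · exact ⟨2 * (6 * m - p), by omega, by omega, by dsimp only; split_ifs <;> omega⟩
      · by_cases c3 : p = 6 * m
        · exact ⟨4 * m - 1, by omega, by omega, by dsimp only; split_ifs <;> omega⟩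
        · exact ⟨2 * (p - 6 * m), by omega, by omega, by dsimp only; split_ifs <;> omega⟩
    · by_cases c2 : p < m - 1
      · exact ⟨4 * m - 1 - 2 * p, by omega, by omega, by dsimp only; split_ifs <;> omega⟩
      · by_cases c3 : p = m - 1 ∨ p = 3 * m
        · exact ⟨2 * m + 1, by omega, by omega, by dsimp only; split_ifs <;> omega⟩
        · by_cases c4 : p = m ∨ p = m + 1
          · obtain ⟨i, hi⟩ : ∃ i, i = 1 := ⟨1, rfl⟩; exact ⟨i, by omega, by omega, by dsimp only; split_ifs <;> omega⟩
          · by_cases c5 : p = 2 * m ∨ p = 4 * m - 1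
            · exact ⟨2 * m - 1, by omega, by omega, by dsimp only; split_ifs <;> omega⟩
            · by_cases c6 : p = 2 * m + 1
              · exact ⟨4 * m - 1, by omega, by omega, by dsimp only; split_ifs <;> omega⟩
              · by_cases c7 : p < 2 * m
                · exact ⟨2 * m - 1 - 2 * (p - m - 1), by omega, by omega, by dsimp only; split_ifs <;> omega⟩
                · by_cases c8 : p < 3 * m
                  · exact ⟨2 * m - 1 - 2 * (3 * m - p), by omega, by omega, by dsimp only; split_ifs <;> omega⟩
                  · exact ⟨4 * m - 1 - 2 * (4 * m - 1 - p), by omega, by omega, by dsimp only; split_ifs <;> omega⟩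

set_option maxHeartbeats 2000000 in
lemma skolem_one (m : ℕ) (hm : 2 ≤ m) : SkolemSys (4 * m + 1) := by
  refine ⟨fun i => 4 * m + 1 + if i % 2 = 0 then 6 * m + 2 - i / 2 else
    if i = 4 * m + 1 then 2 * m + 1 else if i = 2 * m - 1 then 2 * m + 2 else
    if i = 1 then m + 1 else
    if 2 * m + 1 ≤ i then (4 * m + 1 - i) / 2 else m + 2 + (2 * m - 1 - i) / 2, ?_, ?_⟩
  · intro i h1 h2; dsimp only; split_ifs <;> omega
  · intro e h1 h2
    obtain ⟨p, rfl⟩ : ∃ p, e = 4 * m + 1 + p := ⟨e - (4 * m + 1), by omega⟩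
    by_cases c1 : 4 * m + 2 ≤ p
    · by_cases c2 : p < 6 * m + 2
      · exact ⟨2 * (6 * m + 2 - p), by omega, by omega, by dsimp only; split_ifs <;> omega⟩
      · by_cases c3 : p = 6 * m + 2
        · exact ⟨4 * m + 1, by omega, by omega, by dsimp only; split_ifs <;> omega⟩
        · exact ⟨2 * (p - (6 * m + 2)), by omega, by omega, by dsimp only; split_ifs <;> omega⟩
    · by_cases c2 : p ≤ m
      · exact ⟨4 * m + 1 - 2 * p, by omega, by omega, by dsimp only; split_ifs <;> omega⟩
      · by_cases c4 : p = m + 1 ∨ p = m + 2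
        · obtain ⟨i, hi⟩ : ∃ i, i = 1 := ⟨1, rfl⟩; exact ⟨i, by omega, by omega, by dsimp only; split_ifs <;> omega⟩
        · by_cases c5 : p = 2 * m + 2 ∨ p = 4 * m + 1
          · exact ⟨2 * m - 1, by omega, by omega, by dsimp only; split_ifs <;> omega⟩
          · by_cases c6 : p = 2 * m + 1
            · exact ⟨4 * m + 1, by omega, by omega, by dsimp only; split_ifs <;> omega⟩
            · by_cases c7 : p < 2 * m + 1
              · exact ⟨2 * m - 1 - 2 * (p - m - 2), by omega, by omega, by dsimp only; split_ifs <;> omega⟩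
              · by_cases c8 : p < 3 * m + 1
                · exact ⟨2 * m - 1 - 2 * (3 * m + 1 - p), by omega, by omega, by dsimp only; split_ifs <;> omega⟩
                · exact ⟨4 * m + 1 - 2 * (4 * m + 1 - p), by omega, by omega, by dsimp only; split_ifs <;> omega⟩

lemma skolem_exists (t : ℕ) (ht : 1 ≤ t) (h : t % 4 = 0 ∨ t % 4 = 1) : SkolemSys t := by
  by_cases h1 : t = 1
  · subst h1; exact skolem_small1
  by_cases h4 : t = 4
  · subst h4; exact skolem_small4
  by_cases h5 : t = 5
  · subst h5; exact skolem_small5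
  rcases h with h | h
  · obtain ⟨m, rfl⟩ : ∃ m, t = 4 * m := ⟨t / 4, by omega⟩
    exact skolem_zero m (by omega)
  · obtain ⟨m, rfl⟩ : ∃ m, t = 4 * m + 1 := ⟨t / 4, by omega⟩
    exact skolem_one m (by omega)

/-- Two-fold Skolem systems: each difference `1, …, r` occurs exactly twice in `(o, o + 4r]`. -/
lemma twofold (r o : ℕ) : ∃ l1 l2 : ℕ → ℕ,
    (∀ c, 1 ≤ c → c ≤ r → o < l1 c ∧ l1 c + c ≤ o + 4 * r ∧ o < l2 c ∧ l2 c + c ≤ o + 4 * r) ∧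
    ∀ e, o < e → e ≤ o + 4 * r → ∃ c, 1 ≤ c ∧ c ≤ r ∧
      (e = l1 c ∨ e = l1 c + c ∨ e = l2 c ∨ e = l2 c + c) := by
  rcases Nat.even_or_odd' r with ⟨q, rfl | rfl⟩
  · refine ⟨fun c => o + if c % 2 = 1 then q - c / 2 else 4 * q + q + 1 - c / 2,
      fun c => o + if c % 2 = 1 then 2 * q + q - c / 2 else
        if c = 2 * q then 4 * q + q + 1 else 6 * q + 1 + q - c / 2, ?_, ?_⟩
    · intro c h1 h2; dsimp only; split_ifs <;> omega
    · intro e h1 h2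
      obtain ⟨p, rfl⟩ : ∃ p, e = o + p := ⟨e - o, by omega⟩
      have key : ∃ c, 1 ≤ c ∧ c ≤ 2 * q ∧
        ((c % 2 = 1 ∧ (p = q - c / 2 ∨ p = q - c / 2 + c ∨ p = 2 * q + q - c / 2 ∨
            p = 2 * q + q - c / 2 + c)) ∨
         (c % 2 = 0 ∧ (p = 4 * q + q + 1 - c / 2 ∨ p = 4 * q + q + 1 - c / 2 + c)) ∨
         (c = 2 * q ∧ (p = 4 * q + q + 1 ∨ p = 4 * q + q + 1 + c)) ∨
         (c % 2 = 0 ∧ c < 2 * q ∧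
            (p = 6 * q + 1 + q - c / 2 ∨ p = 6 * q + 1 + q - c / 2 + c))) := by
        by_cases c1 : p ≤ q
        · exact ⟨2 * (q - p) + 1, by omega, by omega, by omega⟩
        by_cases c2 : p ≤ 2 * q
        · exact ⟨2 * (p - q - 1) + 1, by omega, by omega, by omega⟩
        by_cases c3 : p ≤ 3 * q
        · exact ⟨2 * (3 * q - p) + 1, by omega, by omega, by omega⟩
        by_cases c4 : p ≤ 4 * q
        · exact ⟨2 * (p - 3 * q - 1) + 1, by omega, by omega, by omega⟩
        by_cases c5 : p = 5 * q + 1 ∨ p = 7 * q + 1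
        · exact ⟨2 * q, by omega, by omega, by omega⟩
        by_cases c6 : p ≤ 5 * q
        · exact ⟨2 * (5 * q + 1 - p), by omega, by omega, by omega⟩
        by_cases c7 : p ≤ 6 * q + 1
        · exact ⟨2 * (p - (5 * q + 1)), by omega, by omega, by omega⟩
        by_cases c8 : p ≤ 7 * q + 1
        · exact ⟨2 * (7 * q + 1 - p), by omega, by omega, by omega⟩
        · exact ⟨2 * (p - (7 * q + 1)), by omega, by omega, by omega⟩
      obtain ⟨i, h1, h2, h⟩ := key
      refine ⟨i, h1, h2, ?_⟩
      dsimp only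
      split_ifs <;> omega
  · refine ⟨fun c => o + if c % 2 = 1 then q + 1 - c / 2 else 4 * q + 2 + q + 1 - c / 2,
      fun c => o + if c = 2 * q + 1 then 4 * q + 2 + q + 1 else
        if c % 2 = 1 then 2 * q + 2 + q - c / 2 else 6 * q + 3 + q + 1 - c / 2, ?_, ?_⟩
    · intro c h1 h2; dsimp only; split_ifs <;> omega
    · intro e h1 h2
      obtain ⟨p, rfl⟩ : ∃ p, e = o + p := ⟨e - o, by omega⟩
      have key : ∃ c, 1 ≤ c ∧ c ≤ 2 * q + 1 ∧
        ((c % 2 = 1 ∧ (p = q + 1 - c / 2 ∨ p = q + 1 - c / 2 + c)) ∨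
         (c % 2 = 1 ∧ c < 2 * q + 1 ∧ (p = 2 * q + 2 + q - c / 2 ∨
            p = 2 * q + 2 + q - c / 2 + c)) ∨
         (c = 2 * q + 1 ∧ (p = 4 * q + 2 + q + 1 ∨ p = 4 * q + 2 + q + 1 + c)) ∨
         (c % 2 = 0 ∧ (p = 4 * q + 2 + q + 1 - c / 2 ∨ p = 4 * q + 2 + q + 1 - c / 2 + c ∨
            p = 6 * q + 3 + q + 1 - c / 2 ∨ p = 6 * q + 3 + q + 1 - c / 2 + c))) := by
        by_cases c1 : p ≤ q + 1
        · exact ⟨2 * (q + 1 - p) + 1, by omega, by omega, by omega⟩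
        by_cases c2 : p ≤ 2 * q + 2
        · exact ⟨2 * (p - q - 2) + 1, by omega, by omega, by omega⟩
        by_cases c3 : p ≤ 3 * q + 2
        · exact ⟨2 * (3 * q + 2 - p) + 1, by omega, by omega, by omega⟩
        by_cases c4 : p ≤ 4 * q + 2
        · exact ⟨2 * (p - 3 * q - 3) + 1, by omega, by omega, by omega⟩
        by_cases c5 : p = 5 * q + 3 ∨ p = 7 * q + 4
        · exact ⟨2 * q + 1, by omega, by omega, by omega⟩
        by_cases c6 : p ≤ 5 * q + 2
        · exact ⟨2 * (5 * q + 3 - p), by omega, by omega, by omega⟩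
        by_cases c7 : p ≤ 6 * q + 3
        · exact ⟨2 * (p - (5 * q + 3)), by omega, by omega, by omega⟩
        by_cases c8 : p ≤ 7 * q + 4
        · exact ⟨2 * (7 * q + 4 - p), by omega, by omega, by omega⟩
        · exact ⟨2 * (p - (7 * q + 4)), by omega, by omega, by omega⟩
      obtain ⟨i, h1, h2, h⟩ := key
      refine ⟨i, h1, h2, ?_⟩
      dsimp only
      split_ifs <;> omega

/-- Long arcs: the differences `D - E, …, D + E`, each used twice, join the interval
`(o, o + 2n]` to `(o + D, o + D + 2n]`, where `n = 2E + 1`. -/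
lemma longarcs (E o D : ℕ) (hD : E ≤ D) : ∃ l1 l2 : ℕ → ℕ,
    (∀ c, D ≤ c + E → c ≤ D + E →
      (o < l1 c ∧ o + D < l1 c + c ∧ l1 c + c ≤ o + D + (4 * E + 2)) ∧
      (o < l2 c ∧ o + D < l2 c + c ∧ l2 c + c ≤ o + D + (4 * E + 2))) ∧
    (∀ e, o < e → e ≤ o + (4 * E + 2) → ∃ c, D ≤ c + E ∧ c ≤ D + E ∧ (e = l1 c ∨ e = l2 c)) ∧
    (∀ e, o + D < e → e ≤ o + D + (4 * E + 2) →
      ∃ c, D ≤ c + E ∧ c ≤ D + E ∧ (e = l1 c + c ∨ e = l2 c + c)) := by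
  refine ⟨fun c => o + if (D + E - c) % 2 = 0 then 1 + (D + E - c) / 2 else
      E + 2 + (D + E - 1 - c) / 2,
    fun c => o + (2 * E + 1) + if (D + E - c) % 2 = 0 then 1 + (D + E - c) / 2 else
      E + 2 + (D + E - 1 - c) / 2, ?_, ?_, ?_⟩
  · intro c h1 h2; dsimp only; split_ifs <;> omega
  · intro e h1 h2
    obtain ⟨p, b, hb, hp1, hp2, rfl⟩ : ∃ p b, (b = 0 ∨ b = 2 * E + 1) ∧ 1 ≤ p ∧ p ≤ 2 * E + 1 ∧
        e = o + b + p := by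
      by_cases c1 : e ≤ o + (2 * E + 1)
      · exact ⟨e - o, 0, by omega, by omega, by omega, by omega⟩
      · exact ⟨e - o - (2 * E + 1), 2 * E + 1, by omega, by omega, by omega, by omega⟩
    by_cases c1 : p ≤ E + 1
    · refine ⟨D + E - 2 * (p - 1), by omega, by omega, ?_⟩
      dsimp only; split_ifs <;> omega
    · refine ⟨D + E - 1 - 2 * (p - E - 2), by omega, by omega, ?_⟩
      dsimp only; split_ifs <;> omega
  · intro e h1 h2
    obtain ⟨p, b, hb, hp1, hp2, rfl⟩ : ∃ p b, (b = 0 ∨ b = 2 * E + 1) ∧ 1 ≤ p ∧ p ≤ 2 * E + 1 ∧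
        e = o + D + b + p := by
      by_cases c1 : e ≤ o + D + (2 * E + 1)
      · exact ⟨e - o - D, 0, by omega, by omega, by omega, by omega⟩
      · exact ⟨e - o - D - (2 * E + 1), 2 * E + 1, by omega, by omega, by omega, by omega⟩
    by_cases c1 : p ≤ E + 1
    · refine ⟨D + E - 2 * (E + 1 - p), by omega, by omega, ?_⟩
      dsimp only; split_ifs <;> omega
    · refine ⟨D + E - 1 - 2 * (2 * E + 1 - p), by omega, by omega, ?_⟩
      dsimp only; split_ifs <;> omega

/-- The quadrilateral data over a Skolem base with `t` triangles. The member `c` of `C` is the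
label of the middle vertex of a 4-cycle `0, l1 c + c, c, l2 c + c`. -/
def Good (t s : ℕ) : Prop :=
  ∃ (C : Finset ℕ) (l1 l2 : ℕ → ℕ), C.card = s ∧
    (∀ c ∈ C, 1 ≤ c ∧ c ≤ 3 * t + 4 * s ∧ (c ≤ t ∨ 3 * t < c)) ∧
    (∀ c ∈ C, 3 * t < l1 c ∧ l1 c + c ≤ 3 * t + 4 * s ∧
      3 * t < l2 c ∧ l2 c + c ≤ 3 * t + 4 * s) ∧
    (∀ c ∈ C, ∀ d ∈ C, c ≠ l1 d + d ∧ c ≠ l2 d + d) ∧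
    (∀ e, 3 * t < e → e ≤ 3 * t + 4 * s → ∃ c ∈ C,
      e = l1 c ∨ e = l1 c + c ∨ e = l2 c ∨ e = l2 c + c)

lemma good_small (t s : ℕ) (h : s ≤ t) : Good t s := by
  obtain ⟨l1, l2, hb, hc⟩ := twofold s (3 * t)
  refine ⟨Finset.Icc 1 s, l1, l2, by simp, ?_, ?_, ?_, ?_⟩
  · intro c hc; rw [Finset.mem_Icc] at hc; omega
  · intro c hc; rw [Finset.mem_Icc] at hc; exact hb c hc.1 hc.2
  · intro c hc d hd; rw [Finset.mem_Icc] at hc hd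
    have := hb d hd.1 hd.2; omega
  · intro e h1 h2
    obtain ⟨c, h1, h2, h⟩ := hc e h1 h2
    exact ⟨c, Finset.mem_Icc.2 ⟨h1, h2⟩, h⟩

lemma good_hybrid (t r E : ℕ) (hr : r ≤ t) (h1 : E + 4 * r ≤ 3 * t)
    (h2 : 3 * t ≤ 3 * E + 1 + 4 * r) : Good t (r + (2 * E + 1)) := by
  obtain ⟨k1, k2, kb, kc⟩ := twofold r (3 * t + (4 * E + 2))
  obtain ⟨m1, m2, mb, mc, md⟩ := longarcs E (3 * t) (4 * E + 2 + 4 * r) (by omega)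
  have memC : ∀ c, c ∈ Finset.Icc 1 r ∪ Finset.Icc (3 * E + 2 + 4 * r) (5 * E + 2 + 4 * r) ↔
      (1 ≤ c ∧ c ≤ r) ∨ (3 * E + 2 + 4 * r ≤ c ∧ c ≤ 5 * E + 2 + 4 * r) := by
    intro c; simp
  have val : ∀ c, c ∈ Finset.Icc 1 r ∪ Finset.Icc (3 * E + 2 + 4 * r) (5 * E + 2 + 4 * r) →
      ((1 ≤ c ∧ c ≤ r ∧ (if c ≤ r then k1 c else m1 c) = k1 c ∧
        (if c ≤ r then k2 c else m2 c) = k2 c) ∨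
       (r < c ∧ 3 * E + 2 + 4 * r ≤ c ∧ c ≤ 5 * E + 2 + 4 * r ∧
        (if c ≤ r then k1 c else m1 c) = m1 c ∧ (if c ≤ r then k2 c else m2 c) = m2 c)) := by
    intro c hc
    rw [memC] at hc
    by_cases h : c ≤ r
    · left; simp [h]; omega
    · right; simp [h]; omega
  refine ⟨Finset.Icc 1 r ∪ Finset.Icc (3 * E + 2 + 4 * r) (5 * E + 2 + 4 * r),
    fun c => if c ≤ r then k1 c else m1 c, fun c => if c ≤ r then k2 c else m2 c,
    ?_, ?_, ?_, ?_, ?_⟩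
  · rw [Finset.card_union_of_disjoint]
    · simp; omega
    · rw [Finset.disjoint_left]; intro c; simp; omega
  · intro c hc; rw [memC] at hc; omega
  · intro c hc
    dsimp only
    rcases val c hc with ⟨g1, g2, e1, e2⟩ | ⟨g0, g1, g2, e1, e2⟩ <;> rw [e1, e2]
    · have := kb c g1 g2; omega
    · have := mb c (by omega) (by omega); omega
  · intro c hc d hd
    dsimp only
    rw [memC] at hc
    rcases val d hd with ⟨g1, g2, e1, e2⟩ | ⟨g0, g1, g2, e1, e2⟩ <;> rw [e1, e2]
    · have := kb d g1 g2; omega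
    · have := mb d (by omega) (by omega); omega
  · intro e g1 g2
    dsimp only
    have fin1 : ∀ c, 1 ≤ c → c ≤ r → (e = k1 c ∨ e = k1 c + c ∨ e = k2 c ∨ e = k2 c + c) →
        ∃ c ∈ Finset.Icc 1 r ∪ Finset.Icc (3 * E + 2 + 4 * r) (5 * E + 2 + 4 * r),
          e = (if c ≤ r then k1 c else m1 c) ∨ e = (if c ≤ r then k1 c else m1 c) + c ∨
          e = (if c ≤ r then k2 c else m2 c) ∨ e = (if c ≤ r then k2 c else m2 c) + c := by
      intro c a1 a2 h
      refine ⟨c, (memC c).2 (by omega), ?_⟩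
      simpa [a2] using h
    have fin2 : ∀ c, 3 * E + 2 + 4 * r ≤ c → c ≤ 5 * E + 2 + 4 * r →
        (e = m1 c ∨ e = m1 c + c ∨ e = m2 c ∨ e = m2 c + c) →
        ∃ c ∈ Finset.Icc 1 r ∪ Finset.Icc (3 * E + 2 + 4 * r) (5 * E + 2 + 4 * r),
          e = (if c ≤ r then k1 c else m1 c) ∨ e = (if c ≤ r then k1 c else m1 c) + c ∨
          e = (if c ≤ r then k2 c else m2 c) ∨ e = (if c ≤ r then k2 c else m2 c) + c := by
      intro c a1 a2 h
      refine ⟨c, (memC c).2 (by omega), ?_⟩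
      have a3 : ¬ c ≤ r := by omega
      simpa [a3] using h
    by_cases c1 : e ≤ 3 * t + (4 * E + 2)
    · obtain ⟨c, a1, a2, h⟩ := mc e g1 c1
      exact fin2 c (by omega) (by omega) (by tauto)
    by_cases c2 : e ≤ 3 * t + (4 * E + 2) + 4 * r
    · obtain ⟨c, a1, a2, h⟩ := kc e (by omega) c2
      exact fin1 c a1 a2 h
    · obtain ⟨c, a1, a2, h⟩ := md e (by omega) (by omega)
      exact fin2 c (by omega) (by omega) (by tauto)

lemma good_extend (t r E : ℕ) (h0 : Good t r) (h1 : E ≤ 3 * t + 4 * r)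
    (h2 : 3 * t + 4 * r ≤ 3 * E + 1) : Good t (r + (2 * E + 1)) := by
  obtain ⟨C, k1, k2, hcard, kr, kb, kd, kc⟩ := h0
  obtain ⟨m1, m2, mb, mc, md⟩ := longarcs E (3 * t + 4 * r) (4 * E + 2) (by omega)
  have memC : ∀ c, c ∈ C ∪ Finset.Icc (3 * E + 2) (5 * E + 2) ↔
      c ∈ C ∨ (3 * E + 2 ≤ c ∧ c ≤ 5 * E + 2) := by
    intro c; simp
  have val : ∀ c, c ∈ C ∪ Finset.Icc (3 * E + 2) (5 * E + 2) →
      ((c ∈ C ∧ (if c ∈ C then k1 c else m1 c) = k1 c ∧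
        (if c ∈ C then k2 c else m2 c) = k2 c) ∨
       (3 * E + 2 ≤ c ∧ c ≤ 5 * E + 2 ∧
        (if c ∈ C then k1 c else m1 c) = m1 c ∧ (if c ∈ C then k2 c else m2 c) = m2 c)) := by
    intro c hc
    rw [memC] at hc
    by_cases h : c ∈ C
    · left; simp [h]
    · right; simp [h]; tauto
  refine ⟨C ∪ Finset.Icc (3 * E + 2) (5 * E + 2),
    fun c => if c ∈ C then k1 c else m1 c, fun c => if c ∈ C then k2 c else m2 c,
    ?_, ?_, ?_, ?_, ?_⟩
  · rw [Finset.card_union_of_disjoint]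
    · simp; omega
    · rw [Finset.disjoint_left]; intro c hc; have := kr c hc; simp; omega
  · intro c hc; rw [memC] at hc
    rcases hc with hc | hc
    · have := kr c hc; omega
    · omega
  · intro c hc
    dsimp only
    rcases val c hc with ⟨g1, e1, e2⟩ | ⟨g1, g2, e1, e2⟩ <;> rw [e1, e2]
    · have := kb c g1; omega
    · have := mb c (by omega) (by omega); omega
  · intro c hc d hd
    dsimp only
    rw [memC] at hc
    rcases val d hd with ⟨g1, e1, e2⟩ | ⟨g1, g2, e1, e2⟩ <;> rw [e1, e2]
    · rcases hc with hc | hc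
      · exact kd c hc d g1
      · have := kb d g1; omega
    · have := mb d (by omega) (by omega)
      rcases hc with hc | hc
      · have := kr c hc; omega
      · omega
  · intro e g1 g2
    dsimp only
    have fin2 : ∀ c, 3 * E + 2 ≤ c → c ≤ 5 * E + 2 →
        (e = m1 c ∨ e = m1 c + c ∨ e = m2 c ∨ e = m2 c + c) →
        ∃ c ∈ C ∪ Finset.Icc (3 * E + 2) (5 * E + 2),
          e = (if c ∈ C then k1 c else m1 c) ∨ e = (if c ∈ C then k1 c else m1 c) + c ∨
          e = (if c ∈ C then k2 c else m2 c) ∨ e = (if c ∈ C then k2 c else m2 c) + c := by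
      intro c a1 a2 h
      refine ⟨c, (memC c).2 (by omega), ?_⟩
      have a3 : ¬ c ∈ C := by intro hc; have := kr c hc; omega
      simpa [a3] using h
    by_cases c1 : e ≤ 3 * t + 4 * r
    · obtain ⟨c, a1, h⟩ := kc e g1 c1
      refine ⟨c, (memC c).2 (Or.inl a1), ?_⟩
      simpa [a1] using h
    by_cases c2 : e ≤ 3 * t + 4 * r + (4 * E + 2)
    · obtain ⟨c, a1, a2, h⟩ := mc e (by omega) c2
      exact fin2 c (by omega) (by omega) (by tauto)
    · obtain ⟨c, a1, a2, h⟩ := md e (by omega) (by omega)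
      exact fin2 c (by omega) (by omega) (by tauto)

/-- Bounded, decidable form of `Good`, for the few sporadic cases. -/
lemma good_of_list (t s : ℕ) (T : List (ℕ × ℕ × ℕ))
    (hT : let C := (T.map Prod.fst).toFinset
      let l1 := fun c => ((T.find? (fun x => x.1 == c)).getD (0, 0, 0)).2.1
      let l2 := fun c => ((T.find? (fun x => x.1 == c)).getD (0, 0, 0)).2.2
      C.card = s ∧
      (∀ c ∈ C, 1 ≤ c ∧ c ≤ 3 * t + 4 * s ∧ (c ≤ t ∨ 3 * t < c)) ∧
      (∀ c ∈ C, 3 * t < l1 c ∧ l1 c + c ≤ 3 * t + 4 * s ∧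
        3 * t < l2 c ∧ l2 c + c ≤ 3 * t + 4 * s) ∧
      (∀ c ∈ C, ∀ d ∈ C, c ≠ l1 d + d ∧ c ≠ l2 d + d) ∧
      (∀ e ∈ Finset.Ioc (3 * t) (3 * t + 4 * s), ∃ c ∈ C,
        e = l1 c ∨ e = l1 c + c ∨ e = l2 c ∨ e = l2 c + c)) : Good t s := by
  obtain ⟨h1, h2, h3, h4, h5⟩ := hT
  exact ⟨_, _, _, h1, h2, h3, h4, fun e a b => h5 e (Finset.mem_Ioc.2 ⟨a, b⟩)⟩

set_option maxRecDepth 100000 in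
lemma good_1_2 : Good 1 2 := good_of_list 1 2 [(1, 4, 8), (4, 6, 7)] (by decide)

set_option maxRecDepth 100000 in
lemma good_1_4 : Good 1 4 :=
  good_of_list 1 4 [(1, 4, 6), (4, 12, 13), (6, 8, 9), (8, 10, 11)] (by decide)

set_option maxRecDepth 100000 in
lemma good_1_9 : Good 1 9 :=
  good_of_list 1 9 [(1, 4, 6), (4, 8, 9), (6, 10, 11), (8, 14, 27), (9, 25, 29), (10, 18, 26),
    (11, 20, 21), (14, 19, 23), (15, 15, 24)] (by decide)

set_option maxRecDepth 100000 in
lemma good_4_6 : Good 4 6 :=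
  good_of_list 4 6 [(1, 13, 15), (2, 17, 22), (3, 25, 29), (4, 26, 27), (13, 21, 23),
    (15, 18, 20)] (by decide)

set_option maxRecDepth 100000 in
lemma good_8_9 : Good 8 9 :=
  good_of_list 8 9 [(1, 25, 27), (2, 29, 30), (3, 33, 37), (4, 38, 39), (5, 41, 51), (6, 44, 52),
    (7, 47, 48), (8, 45, 49), (25, 34, 35)] (by decide)

lemma good_all (t : ℕ) (ht : 1 ≤ t) (h : t % 4 = 0 ∨ t % 4 = 1) (s : ℕ) : Good t s := by
  induction s using Nat.strong_induction_on with
  | _ s ih =>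
    by_cases c0 : s ≤ t
    · exact good_small t s c0
    by_cases c1 : ∃ r E, s = r + (2 * E + 1) ∧ r ≤ t ∧ E + 4 * r ≤ 3 * t ∧
        3 * t ≤ 3 * E + 1 + 4 * r
    · obtain ⟨r, E, rfl, h1, h2, h3⟩ := c1
      exact good_hybrid t r E h1 h2 h3
    by_cases c2 : ∃ r E, s = r + (2 * E + 1) ∧ E ≤ 3 * t + 4 * r ∧ 3 * t + 4 * r ≤ 3 * E + 1
    · obtain ⟨r, E, rfl, h1, h2⟩ := c2
      exact good_extend t r E (ih r (by omega)) h1 h2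
    have key : (t = 1 ∧ s = 2) ∨ (t = 1 ∧ s = 4) ∨ (t = 1 ∧ s = 9) ∨ (t = 4 ∧ s = 6) ∨
        (t = 8 ∧ s = 9) := by
      by_contra hne
      have gen : (2 * ((4 * s - 3 * t - 4 + 6) / 7) + 1 ≤ s ∧
          5 * ((4 * s - 3 * t - 4 + 6) / 7) ≤ 4 * s - 3 * t - 3) ∨
          (2 * ((3 * t + 4 * s - 5 + 10) / 11) + 1 ≤ s ∧
          9 * ((3 * t + 4 * s - 5 + 10) / 11) ≤ 3 * t + 4 * s - 4) := by
        by_cases big : 9 ≤ t ∨ 14 ≤ s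
        · omega
        · have : t < 9 := by omega
          have : s < 14 := by omega
          interval_cases t <;> first | omega | (interval_cases s <;> omega)
      rcases gen with ⟨g1, g2⟩ | ⟨g1, g2⟩
      · exact c1 ⟨s - (2 * ((4 * s - 3 * t - 4 + 6) / 7) + 1), (4 * s - 3 * t - 4 + 6) / 7,
          by omega, by omega, by omega, by omega⟩
      · exact c2 ⟨s - (2 * ((3 * t + 4 * s - 5 + 10) / 11) + 1),
          (3 * t + 4 * s - 5 + 10) / 11, by omega, by omega, by omega⟩
    rcases key with ⟨rfl, rfl⟩ | ⟨rfl, rfl⟩ | ⟨rfl, rfl⟩ | ⟨rfl, rfl⟩ | ⟨rfl, rfl⟩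
    · exact good_1_2
    · exact good_1_4
    · exact good_1_9
    · exact good_4_6
    · exact good_8_9

/-- The vertex at position `j` of vane `i`; positions outside the vane give the centre. -/
def vtx (L : List ℕ) (i j : ℕ) : WindmillVertex L :=
  if h : i < L.length then
    if h' : 1 ≤ j ∧ j - 1 < L.get ⟨i, h⟩ - 1 then some ⟨⟨i, h⟩, ⟨j - 1, h'.2⟩⟩ else none
  else none

/-- The labelling of the windmill read off from an array of labels. -/
def arrLabel (L : List ℕ) (F : ℕ → ℕ → ℕ) : WindmillVertex L → ℕ
  | none => 0
  | some ⟨i, j⟩ => F i.val (j.val + 1)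

lemma vtx_succ (L : List ℕ) (i : Fin L.length) (j : Fin (L.get i - 1)) :
    vtx L i.val (j.val + 1) = some ⟨i, j⟩ := by
  have h' : 1 ≤ j.val + 1 ∧ j.val + 1 - 1 < L.get ⟨i.val, i.isLt⟩ - 1 :=
    ⟨by omega, by simp⟩
  unfold vtx
  rw [dif_pos i.isLt, dif_pos h']
  rfl

lemma vtx_zero (L : List ℕ) (i : ℕ) : vtx L i 0 = none := by
  unfold vtx
  split_ifs with h h'
  · omega
  · rfl
  · rfl

lemma vtx_last (L : List ℕ) (i : Fin L.length) (j : ℕ) (hj : L.get i ≤ j) :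
    vtx L i.val j = none := by
  unfold vtx
  rw [dif_pos i.isLt, dif_neg]
  rintro ⟨h1, h2⟩
  have : j - 1 < L.get i - 1 := h2
  omega

lemma arrLabel_vtx (L : List ℕ) (F : ℕ → ℕ → ℕ) (i : Fin L.length) (h3 : 3 ≤ L.get i)
    (h0 : F i.val 0 = 0) (hl : F i.val (L.get i) = 0) (j : ℕ) (hj : j ≤ L.get i) :
    arrLabel L F (vtx L i.val j) = F i.val j := by
  rcases Nat.eq_zero_or_pos j with rfl | hp
  · rw [vtx_zero, h0]; rfl
  rcases Nat.lt_or_ge j (L.get i) with hlt | hge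
  · have := vtx_succ L i ⟨j - 1, by omega⟩
    simp only at this
    rw [show j - 1 + 1 = j by omega] at this
    rw [this]
    show F i.val (j - 1 + 1) = _
    rw [show j - 1 + 1 = j by omega]
  · have : j = L.get i := by omega
    subst this
    rw [vtx_last L i _ le_rfl, hl]; rfl

lemma windmill_adj_vtx (L : List ℕ) (i : Fin L.length) (h3 : 3 ≤ L.get i) (j : ℕ)
    (hj : j < L.get i) : (Windmill L).Adj (vtx L i.val j) (vtx L i.val (j + 1)) := by
  unfold Windmill
  rw [SimpleGraph.fromRel_adj]
  rcases Nat.eq_zero_or_pos j with rfl | hp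
  · have := vtx_succ L i ⟨0, by omega⟩
    simp only at this
    rw [vtx_zero, this]
    refine ⟨by simp, Or.inl (Or.inl rfl)⟩
  · have h1 := vtx_succ L i ⟨j - 1, by omega⟩
    simp only at h1
    rw [show j - 1 + 1 = j by omega] at h1
    rw [h1]
    rcases Nat.lt_or_ge (j + 1) (L.get i) with hlt | hge
    · have h2 := vtx_succ L i ⟨j, by omega⟩
      simp only at h2
      rw [h2]
      refine ⟨?_, Or.inl ⟨rfl, ?_⟩⟩
      · intro h
        simp at h
        omega
      · show j = j - 1 + 1
        omega
    · rw [vtx_last L i _ hge]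
      refine ⟨by simp, Or.inr (Or.inr ?_)⟩
      show j - 1 + 2 = L.get i
      omega

lemma windmill_rel_vtx (L : List ℕ) (u v : WindmillVertex L) (h : windmillRel L u v) :
    ∃ (i : Fin L.length) (j : ℕ), j < L.get i ∧
      s(u, v) = s(vtx L i.val j, vtx L i.val (j + 1)) := by
  rcases u with _ | ⟨i, j⟩ <;> rcases v with _ | ⟨i', j'⟩
  · exact h.elim
  · have hj := j'.isLt
    rcases h with h | h
    · refine ⟨i', 0, by omega, ?_⟩
      rw [vtx_zero, ← vtx_succ, h]
    · refine ⟨i', j'.val + 1, by omega, ?_⟩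
      rw [vtx_last L i' (j'.val + 1 + 1) (by omega), ← vtx_succ, Sym2.eq_swap]
  · exact h.elim
  · obtain ⟨h1, h2⟩ := h
    have h1 := Fin.ext h1
    subst h1
    have hj := j'.isLt
    refine ⟨i, j.val + 1, by omega, ?_⟩
    rw [← vtx_succ, ← vtx_succ, h2]

lemma windmill_edge_vtx (L : List ℕ) (e : Sym2 (WindmillVertex L))
    (h : e ∈ (Windmill L).edgeSet) :
    ∃ (i : Fin L.length) (j : ℕ), j < L.get i ∧
      e = s(vtx L i.val j, vtx L i.val (j + 1)) := by
  induction e with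
  | h u v =>
    rw [SimpleGraph.mem_edgeSet, Windmill, SimpleGraph.fromRel_adj] at h
    rcases h.2 with h | h
    · exact windmill_rel_vtx L u v h
    · obtain ⟨i, j, hj, he⟩ := windmill_rel_vtx L v u h
      exact ⟨i, j, hj, by rw [Sym2.eq_swap, he]⟩

/-- A criterion for gracefulness of a windmill in terms of an array of labels. -/
lemma windmill_graceful (L : List ℕ) (F lab : ℕ → ℕ → ℕ) (m : ℕ)
    (h3 : ∀ i : Fin L.length, 3 ≤ L.get i)
    (h0 : ∀ i : Fin L.length, F i.val 0 = 0)
    (hl : ∀ i : Fin L.length, F i.val (L.get i) = 0)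
    (hinj : ∀ (i : Fin L.length) (j : ℕ) (i' : Fin L.length) (j' : ℕ), 1 ≤ j → j < L.get i →
      1 ≤ j' → j' < L.get i' → F i.val j = F i'.val j' → i = i' ∧ j = j')
    (hpos : ∀ (i : Fin L.length) (j : ℕ), 1 ≤ j → j < L.get i → 1 ≤ F i.val j ∧ F i.val j ≤ m)
    (hlab : ∀ (i : Fin L.length) (j : ℕ), j < L.get i →
      ((F i.val j : ℤ) - (F i.val (j + 1) : ℤ)).natAbs = lab i.val j)
    (hrange : ∀ (i : Fin L.length) (j : ℕ), j < L.get i → 1 ≤ lab i.val j ∧ lab i.val j ≤ m)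
    (hlinj : ∀ (i : Fin L.length) (j : ℕ) (i' : Fin L.length) (j' : ℕ), j < L.get i →
      j' < L.get i' → lab i.val j = lab i'.val j' → i = i' ∧ j = j')
    (hsurj : ∀ e, 1 ≤ e → e ≤ m → ∃ (i : Fin L.length) (j : ℕ), j < L.get i ∧ lab i.val j = e) :
    IsGraceful (Windmill L) m := by
  have hel : ∀ (i : Fin L.length) (j : ℕ), j < L.get i →
      edgeLabel (arrLabel L F) s(vtx L i.val j, vtx L i.val (j + 1)) = lab i.val j := by
    intro i j hj
    rw [← hlab i j hj, ← arrLabel_vtx L F i (h3 i) (h0 i) (hl i) j hj.le,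
      ← arrLabel_vtx L F i (h3 i) (h0 i) (hl i) (j + 1) hj]
    rfl
  refine ⟨arrLabel L F, ?_, ?_, ?_, ?_, ?_⟩
  · rintro (_ | ⟨i, j⟩) (_ | ⟨i', j'⟩) h
    · rfl
    · have hj := j'.isLt
      have := hpos i' (j'.val + 1) (by omega) (by omega)
      have h' : 0 = F i'.val (j'.val + 1) := h
      omega
    · have hj := j.isLt
      have := hpos i (j.val + 1) (by omega) (by omega)
      have h' : F i.val (j.val + 1) = 0 := h
      omega
    · have hj := j.isLt
      have hj' := j'.isLt
      obtain ⟨h1, h2⟩ := hinj i (j.val + 1) i' (j'.val + 1) (by omega) (by omega) (by omega)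
        (by omega) h
      rw [← vtx_succ, ← vtx_succ, h2, h1]
  · rintro (_ | ⟨i, j⟩)
    · exact Nat.zero_le _
    · have hj := j.isLt
      exact (hpos i (j.val + 1) (by omega) (by omega)).2
  · intro e he
    obtain ⟨i, j, hj, rfl⟩ := windmill_edge_vtx L e he
    rw [hel i j hj]
    exact hrange i j hj
  · intro e he e' he' hee
    obtain ⟨i, j, hj, rfl⟩ := windmill_edge_vtx L e he
    obtain ⟨i', j', hj', rfl⟩ := windmill_edge_vtx L e' he'
    rw [hel i j hj, hel i' j' hj'] at hee
    obtain ⟨h1, h2⟩ := hlinj i j i' j' hj hj' hee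
    rw [h1, h2]
  · intro e he
    obtain ⟨i, j, hj, h⟩ := hsurj e he.1 he.2
    exact ⟨s(vtx L i.val j, vtx L i.val (j + 1)), windmill_adj_vtx L i (h3 i) j hj,
      by rw [hel i j hj, h]⟩

lemma exists_enum (C : Finset ℕ) (s : ℕ) (hs : C.card = s) : ∃ cc : ℕ → ℕ,
    (∀ i, i < s → cc i ∈ C) ∧ (∀ i j, i < s → j < s → cc i = cc j → i = j) ∧
    ∀ c ∈ C, ∃ i, i < s ∧ cc i = c := by
  let e := C.equivFinOfCardEq hs
  have hv : ∀ (i : ℕ) (h : i < s),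
      (fun i => if h : i < s then ((e.symm ⟨i, h⟩ : C) : ℕ) else 0) i = (e.symm ⟨i, h⟩ : C) := by
    intro i h
    simp only [dif_pos h]
  refine ⟨fun i => if h : i < s then ((e.symm ⟨i, h⟩ : C) : ℕ) else 0, ?_, ?_, ?_⟩
  · intro i h
    rw [hv i h]
    exact (e.symm ⟨i, h⟩).2
  · intro i j hi hj h
    rw [hv i hi, hv j hj] at h
    have := e.symm.injective (Subtype.ext h)
    simpa using this
  · intro c hc
    refine ⟨(e ⟨c, hc⟩).val, (e ⟨c, hc⟩).isLt, ?_⟩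
    rw [hv _ (e ⟨c, hc⟩).isLt]
    simp

lemma lab_inj (t s : ℕ) (lab : ℕ → ℕ → ℕ)
    (hrange : ∀ i j, i < t + s → j < (if i < t then 3 else 4) →
      1 ≤ lab i j ∧ lab i j ≤ 3 * t + 4 * s)
    (hsurj : ∀ e, 1 ≤ e → e ≤ 3 * t + 4 * s → ∃ i j, i < t + s ∧ j < (if i < t then 3 else 4) ∧
      lab i j = e) :
    ∀ i j i' j', i < t + s → j < (if i < t then 3 else 4) → i' < t + s →
      j' < (if i' < t then 3 else 4) → lab i j = lab i' j' → i = i' ∧ j = j' := by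
  let K : Finset (ℕ × ℕ) :=
    Finset.range t ×ˢ Finset.range 3 ∪ Finset.Ico t (t + s) ×ˢ Finset.range 4
  have hK : ∀ i j, (i, j) ∈ K ↔ i < t + s ∧ j < (if i < t then 3 else 4) := by
    intro i j
    simp only [K, Finset.mem_union, Finset.mem_product, Finset.mem_range, Finset.mem_Ico]
    split_ifs <;> omega
  have hcard : K.card ≤ (Finset.Icc 1 (3 * t + 4 * s)).card := by
    refine (Finset.card_union_le _ _).trans ?_
    simp only [Finset.card_product, Finset.card_range, Nat.card_Ico, Nat.card_Icc]
    omega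
  have hI : Set.InjOn (fun q : ℕ × ℕ => lab q.1 q.2) (K : Set (ℕ × ℕ)) := by
    refine Finset.injOn_of_surjOn_of_card_le (t := Finset.Icc 1 (3 * t + 4 * s)) _ ?_ ?_ hcard
    · rintro ⟨i, j⟩ hq
      have hq' := (hK i j).1 hq
      have := hrange i j hq'.1 hq'.2
      simpa using this
    · intro e he
      simp only [Finset.coe_Icc, Set.mem_Icc] at he
      obtain ⟨i, j, hi, hj, h⟩ := hsurj e he.1 he.2
      exact ⟨(i, j), (hK i j).2 ⟨hi, hj⟩, h⟩
  intro i j i' j' hi hj hi' hj' h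
  have := hI ((hK i j).2 ⟨hi, hj⟩) ((hK i' j').2 ⟨hi', hj'⟩) h
  simpa using this

lemma graceful_of_good (t s : ℕ) (hS : SkolemSys t) (hG : Good t s) :
    IsGraceful (Windmill (List.replicate t 3 ++ List.replicate s 4)) (3 * t + 4 * s) := by
  obtain ⟨a, ha1, ha2⟩ := hS
  obtain ⟨C, l1, l2, hC, hc1, hc2, hc3, hc4⟩ := hG
  obtain ⟨cc, hcm, hci, hcs⟩ := exists_enum C s hC
  let L := List.replicate t 3 ++ List.replicate s 4
  have hlen : L.length = t + s := by simp [L]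
  have hget : ∀ i : Fin L.length, L.get i = if i.val < t then 3 else 4 := by
    intro i
    simp only [L, List.get_eq_getElem, List.getElem_append, List.getElem_replicate,
      List.length_replicate]
    split_ifs <;> rfl
  let F : ℕ → ℕ → ℕ := fun i j =>
    if i < t then (if j = 1 then a (i + 1) else if j = 2 then a (i + 1) + (i + 1) else 0)
    else if j = 1 then l1 (cc (i - t)) + cc (i - t) else if j = 2 then cc (i - t) else
      if j = 3 then l2 (cc (i - t)) + cc (i - t) else 0
  let lab : ℕ → ℕ → ℕ := fun i j =>
    if i < t then (if j = 0 then a (i + 1) else if j = 1 then i + 1 else a (i + 1) + (i + 1))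
    else if j = 0 then l1 (cc (i - t)) + cc (i - t) else if j = 1 then l1 (cc (i - t)) else
      if j = 2 then l2 (cc (i - t)) else l2 (cc (i - t)) + cc (i - t)
  have hcmem : ∀ i, i < t + s → ¬ i < t → cc (i - t) ∈ C := fun i hi hn => hcm _ (by omega)
  have hrange : ∀ i j, i < t + s → j < (if i < t then 3 else 4) →
      1 ≤ lab i j ∧ lab i j ≤ 3 * t + 4 * s := by
    intro i j hi hj
    by_cases hit : i < t
    · have := ha1 (i + 1) (by omega) (by omega)
      simp only [lab, if_pos hit]
      split_ifs <;> omega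
    · have hm := hcmem i hi hit
      have := hc1 _ hm
      have := hc2 _ hm
      simp only [lab, if_neg hit]
      split_ifs <;> omega
  have hsurj : ∀ e, 1 ≤ e → e ≤ 3 * t + 4 * s →
      ∃ i j, i < t + s ∧ j < (if i < t then 3 else 4) ∧ lab i j = e := by
    intro e h1 h2
    by_cases e1 : e ≤ t
    · have hit : e - 1 < t := by omega
      refine ⟨e - 1, 1, by omega, by rw [if_pos hit]; omega, ?_⟩
      simp only [lab, if_pos hit]
      norm_num
      omega
    by_cases e2 : e ≤ 3 * t
    · obtain ⟨i, hi1, hi2, h⟩ := ha2 e (by omega) e2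
      have hit : i - 1 < t := by omega
      have hi : i - 1 + 1 = i := by omega
      rcases h with h | h
      · refine ⟨i - 1, 0, by omega, by rw [if_pos hit]; omega, ?_⟩
        simp only [lab, if_pos hit, hi]
        norm_num
        omega
      · refine ⟨i - 1, 2, by omega, by rw [if_pos hit]; omega, ?_⟩
        simp only [lab, if_pos hit, hi]
        norm_num
        omega
    · obtain ⟨c, hc, h⟩ := hc4 e (by omega) h2
      obtain ⟨i, hi, rfl⟩ := hcs c hc
      have hit : ¬ (t + i < t) := by omega
      have hii : t + i - t = i := by omega
      rcases h with h | h | h | h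
      · refine ⟨t + i, 1, by omega, by rw [if_neg hit]; omega, ?_⟩
        simp only [lab, if_neg hit, hii]
        norm_num
        omega
      · refine ⟨t + i, 0, by omega, by rw [if_neg hit]; omega, ?_⟩
        simp only [lab, if_neg hit, hii]
        norm_num
        omega
      · refine ⟨t + i, 2, by omega, by rw [if_neg hit]; omega, ?_⟩
        simp only [lab, if_neg hit, hii]
        norm_num
        omega
      · refine ⟨t + i, 3, by omega, by rw [if_neg hit]; omega, ?_⟩
        simp only [lab, if_neg hit, hii]
        norm_num
        omega
  have hlinj := lab_inj t s lab hrange hsurj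
  -- every non-central vertex is a neighbour of the centre or a middle vertex
  have hF : ∀ i j, i < t + s → 1 ≤ j → j < (if i < t then 3 else 4) →
      (∃ j', j' < (if i < t then 3 else 4) ∧ F i j = lab i j' ∧
        ((j = 1 ∧ j' = 0) ∨ (j ≠ 1 ∧ j' = j)) ∧
        ∀ c ∈ C, c ≠ F i j) ∨
      (¬ i < t ∧ j = 2 ∧ F i j = cc (i - t)) := by
    intro i j hi h1 hj
    by_cases hit : i < t
    · left
      have ha := ha1 (i + 1) (by omega) (by omega)
      rw [if_pos hit] at hj ⊢
      obtain rfl | rfl : j = 1 ∨ j = 2 := by omega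
      · refine ⟨0, by omega, by simp [F, lab, hit], by omega, ?_⟩
        intro c hc
        have := hc1 c hc
        simp only [F, if_pos hit, if_true]
        omega
      · refine ⟨2, by omega, by simp [F, lab, hit], by omega, ?_⟩
        intro c hc
        have := hc1 c hc
        simp only [F, if_pos hit, if_true]
        norm_num
        omega
    · rw [if_neg hit] at hj ⊢
      have hm := hcmem i hi hit
      obtain rfl | rfl | rfl : j = 1 ∨ j = 2 ∨ j = 3 := by omega
      · left
        refine ⟨0, by omega, by simp [F, lab, hit], by omega, ?_⟩
        intro c hc
        have := (hc3 c hc _ hm).1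
        simpa [F, hit] using this
      · right
        exact ⟨hit, rfl, by simp [F, hit]⟩
      · left
        refine ⟨3, by omega, by simp [F, lab, hit], by omega, ?_⟩
        intro c hc
        have := (hc3 c hc _ hm).2
        simpa [F, hit] using this
  refine windmill_graceful L F lab (3 * t + 4 * s) ?_ ?_ ?_ ?_ ?_ ?_ ?_ ?_ ?_
  · intro i
    rw [hget]
    split_ifs <;> omega
  · intro i
    simp [F]
  · intro i
    rw [hget]
    by_cases hit : i.val < t <;> simp [F, hit]
  · intro i j i' j' h1 h2 h3 h4 h
    rw [hget] at h2 h4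
    have hi : i.val < t + s := hlen ▸ i.isLt
    have hi' : i'.val < t + s := hlen ▸ i'.isLt
    suffices hh : i.val = i'.val ∧ j = j' from ⟨Fin.ext hh.1, hh.2⟩
    rcases hF i j hi h1 h2 with ⟨k, hk, hk1, hk2, hk3⟩ | ⟨hit, hj, hk⟩ <;>
      rcases hF i' j' hi' h3 h4 with ⟨k', hk', hk1', hk2', hk3'⟩ | ⟨hit', hj', hk'⟩
    · have := hlinj i k i' k' hi hk hi' hk' (by rw [← hk1, ← hk1', h])
      omega
    · exact absurd (hk'.symm.trans h.symm) (hk3 _ (hcmem _ hi' hit'))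
    · exact absurd (hk.symm.trans h) (hk3' _ (hcmem _ hi hit))
    · have := hci (i.val - t) (i'.val - t) (by omega) (by omega) (by rw [← hk, ← hk', h])
      omega
  · intro i j h1 h2
    rw [hget] at h2
    have hi : i.val < t + s := hlen ▸ i.isLt
    rcases hF i j hi h1 h2 with ⟨k, hk, hk1, hk2, hk3⟩ | ⟨hit, hj, hk⟩
    · rw [hk1]
      exact hrange i k hi hk
    · rw [hk]
      have := hc1 _ (hcmem _ hi hit)
      omega
  · intro i j hj
    rw [hget] at hj
    by_cases hit : i.val < t
    · rw [if_pos hit] at hj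
      obtain rfl | rfl | rfl : j = 0 ∨ j = 1 ∨ j = 2 := by omega
      · simp [F, lab, hit]
      · simp [F, lab, hit]
        try omega
      · simp [F, lab, hit]
        try omega
    · rw [if_neg hit] at hj
      obtain rfl | rfl | rfl | rfl : j = 0 ∨ j = 1 ∨ j = 2 ∨ j = 3 := by omega
      · simp [F, lab, hit]
        try omega
      · simp [F, lab, hit]
        try omega
      · simp [F, lab, hit]
        try omega
      · simp [F, lab, hit]
        try omega
  · intro i j hj
    rw [hget] at hj
    exact hrange i j (hlen ▸ i.isLt) hj
  · intro i j i' j' hj hj' h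
    rw [hget] at hj hj'
    have := hlinj i j i' j' (hlen ▸ i.isLt) hj (hlen ▸ i'.isLt) hj' h
    exact ⟨Fin.ext this.1, this.2⟩
  · intro e h1 h2
    obtain ⟨i, j, hi, hj, h⟩ := hsurj e h1 h2
    exact ⟨⟨i, hlen ▸ hi⟩, j, by rw [hget]; exact hj, h⟩

/-- Let `k ≥ 1`, `x ≥ 1`, `w ≥ 0` and `s ≥ 1` be integers, and suppose that either
(1) `x ≡ 0 (mod 4)`, `w ≥ 1`, and `(2k − 12w + 2)/4 ≤ s ≤ (6k − 12w − 5)/4`, or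
(2) `x ≡ 1 (mod 4)` and `(2k − 12w − 1)/4 ≤ s ≤ (6k − 12w − 8)/4`.
If a graceful labelling of `C₃^{4w+x}C₄^{s}` exists, then a graceful labelling of
`C₃^{4w+x}C₄^{s+4k−1}` exists. -/
theorem graceful_extension (k x w s : ℕ) (hk : 1 ≤ k) (hx : 1 ≤ x) (hs : 1 ≤ s)
    (hcase :
      (x % 4 = 0 ∧ 1 ≤ w ∧
        2 * (k : ℤ) - 12 * (w : ℤ) + 2 ≤ 4 * (s : ℤ) ∧
        4 * (s : ℤ) ≤ 6 * (k : ℤ) - 12 * (w : ℤ) - 5) ∨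
      (x % 4 = 1 ∧
        2 * (k : ℤ) - 12 * (w : ℤ) - 1 ≤ 4 * (s : ℤ) ∧
        4 * (s : ℤ) ≤ 6 * (k : ℤ) - 12 * (w : ℤ) - 8))
    (h : IsGraceful
      (Windmill (List.replicate (4 * w + x) 3 ++ List.replicate s 4))
      (3 * (4 * w + x) + 4 * s)) :
    IsGraceful
      (Windmill (List.replicate (4 * w + x) 3 ++ List.replicate (s + 4 * k - 1) 4))
      (3 * (4 * w + x) + 4 * (s + 4 * k - 1)) := by
  have ht : 1 ≤ 4 * w + x := by omega
  have hm : (4 * w + x) % 4 = 0 ∨ (4 * w + x) % 4 = 1 := by omega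
  exact graceful_of_good _ _ (skolem_exists _ ht hm) (good_all _ ht hm _)
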